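/- arXiv:2603.08158 — 4 statements merged into one kernel-verified Lean document; each statement's English description precedes it below -/
import Mathlib

section
/- (Quadratic majorization of the Huber loss.) For every τ > 0 and all real numbers r and r₀, one has ρ_τ(r) ≤ ρ_τ(r₀) + (w_τ(r₀)/2)·(r² − r₀²), with equality when r = r₀. In other words, the quadratic surrogate r ↦ (w_τ(r₀)/2)·r² + ρ_τ(r₀) − (w_τ(r₀)/2)·r₀² majorizes ρ_τ and touches it at r₀. -/
/-- The Huber loss with threshold `τ`. -/
noncomputable def huber (τ r : ℝ) : ℝ := if |r| ≤ τ then r ^ 2 / 2 else τ * (|r| - τ / 2)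

/-- The Huber weight with threshold `τ`. -/
noncomputable def huberWeight (τ r : ℝ) : ℝ := if |r| ≤ τ then 1 else τ / |r|

/-- Quadratic majorization of the Huber loss: for every `τ > 0` and all `r r₀ : ℝ`,
`huber τ r ≤ huber τ r₀ + (huberWeight τ r₀ / 2) * (r² − r₀²)`, with equality when `r = r₀`. -/
theorem huber_quadratic_majorization (τ : ℝ) (hτ : 0 < τ) (r r₀ : ℝ) :
    huber τ r ≤ huber τ r₀ + huberWeight τ r₀ / 2 * (r ^ 2 - r₀ ^ 2) ∧
      (r = r₀ → huber τ r = huber τ r₀ + huberWeight τ r₀ / 2 * (r ^ 2 - r₀ ^ 2)) := by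
  refine ⟨?_, fun h => by subst h; ring⟩
  have ha := abs_nonneg r
  unfold huber huberWeight
  rw [← sq_abs r, ← sq_abs r₀]
  generalize |r| = a at *
  generalize |r₀| = b
  by_cases hb : b ≤ τ
  · simp only [if_pos hb]
    split_ifs with h
    · linarith
    · nlinarith [sq_nonneg (a - τ)]
  · simp only [if_neg hb]
    push Not at hb
    have hb0 : 0 < b := hτ.trans hb
    have hdiv : τ / b / 2 * (a ^ 2 - b ^ 2) = τ * (a ^ 2 - b ^ 2) / (2 * b) := by
      field_simp
    rw [hdiv, ← sub_le_iff_le_add', le_div_iff₀ (by positivity)]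
    split_ifs with h
    · have hab : a ^ 2 ≤ τ * b := by nlinarith
      nlinarith [mul_nonneg (sub_nonneg.2 hb.le) (sub_nonneg.2 hab)]
    · nlinarith [mul_nonneg hτ.le (sq_nonneg (a - b))]
end

section
/- (Monotone descent of the IRLS step, part of Theorem 1.) Let τ > 0, let A be a real N×p matrix and b ∈ ℝ^N, and define the Huber objective f(θ) = Σ_{i=1}^N ρ_τ(b_i − (Aθ)_i). Fix θ ∈ ℝ^p, set the weights w_i = w_τ(b_i − (Aθ)_i), and suppose θ⁺ ∈ ℝ^p minimizes the weighted least-squares surrogate g(η) = Σ_{i=1}^N w_i·(b_i − (Aη)_i)² over all η ∈ ℝ^p. Then f(θ⁺) ≤ f(θ). -/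
/-- The Huber loss is majorized by the quadratic with curvature `huberWeight τ r` that
agrees with it at `r`. -/
lemma huber_le_huber_add_weight {τ : ℝ} (hτ : 0 < τ) (r s : ℝ) :
    huber τ s ≤ huber τ r + huberWeight τ r * (s ^ 2 - r ^ 2) / 2 := by
  unfold huber huberWeight
  have hs := abs_nonneg s
  rw [← sq_abs r, ← sq_abs s]
  generalize |r| = x at *
  generalize |s| = y at *
  by_cases hx : x ≤ τ
  · simp only [hx, if_true]
    split_ifs
    · linarith
    · nlinarith [sq_nonneg (y - τ)]
  · simp only [hx, if_false]
    push Not at hx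
    have hx0 : 0 < x := hτ.trans hx
    have key : τ * (x - τ / 2) + τ / x * (y ^ 2 - x ^ 2) / 2
        = (τ * x ^ 2 - τ ^ 2 * x + τ * y ^ 2) / (2 * x) := by
      field_simp
      ring
    rw [key, le_div_iff₀ (by positivity)]
    split_ifs with hy
    · have hyx : y ^ 2 ≤ τ * x := by nlinarith
      nlinarith [mul_nonneg (sub_nonneg.2 hx.le) (sub_nonneg.2 hyx)]
    · nlinarith [mul_nonneg hτ.le (sq_nonneg (y - x))]

/-- Monotone descent of the IRLS step: if `θ⁺` minimizes the weighted least-squares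
surrogate with weights `w i = huberWeight τ (b i − (Aθ)_i)`, then the Huber objective
does not increase: `f θ⁺ ≤ f θ`. -/
theorem irls_step_descent {N p : ℕ} (τ : ℝ) (hτ : 0 < τ)
    (A : Matrix (Fin N) (Fin p) ℝ) (b : Fin N → ℝ) (θ θplus : Fin p → ℝ)
    (hmin : ∀ η : Fin p → ℝ,
      ∑ i, huberWeight τ (b i - A.mulVec θ i) * (b i - A.mulVec θplus i) ^ 2 ≤
        ∑ i, huberWeight τ (b i - A.mulVec θ i) * (b i - A.mulVec η i) ^ 2) :
    ∑ i, huber τ (b i - A.mulVec θplus i) ≤ ∑ i, huber τ (b i - A.mulVec θ i) := by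
  have hmaj := Finset.sum_le_sum fun i (_ : i ∈ Finset.univ) =>
    huber_le_huber_add_weight hτ (b i - A.mulVec θ i) (b i - A.mulVec θplus i)
  rw [Finset.sum_add_distrib, ← Finset.sum_div] at hmaj
  simp only [mul_sub, Finset.sum_sub_distrib] at hmaj
  linarith [hmin θ]
end

section
/- (Convergence of IRLS objective values, part of Theorem 1.) Let τ > 0, A a real N×p matrix, b ∈ ℝ^N, and f(θ) = Σ_{i=1}^N ρ_τ(b_i − (Aθ)_i). Suppose (θ^{(t)})_{t≥0} is a sequence in ℝ^p such that for every t, θ^{(t+1)} minimizes η ↦ Σ_{i=1}^N w_τ(b_i − (Aθ^{(t)})_i)·(b_i − (Aη)_i)² over ℝ^p. Then the sequence of objective values f(θ^{(t)}) is nonincreasing, nonnegative, and converges. -/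
/-- The Huber loss is majorized by the quadratic with curvature `huberWeight τ r` that touches it
at `r`. -/
theorem huber_le_huber_add_huberWeight {τ : ℝ} (hτ : 0 < τ) (r s : ℝ) :
    huber τ s ≤ huber τ r + (huberWeight τ r * s ^ 2 - huberWeight τ r * r ^ 2) / 2 := by
  unfold huber huberWeight
  rw [← sq_abs r, ← sq_abs s]
  have hs : 0 ≤ |s| := abs_nonneg s
  generalize |r| = x at *
  generalize |s| = y at *
  by_cases hx : x ≤ τ
  · simp only [if_pos hx]
    split_ifs
    · linarith
    · nlinarith [sq_nonneg (y - τ)]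
  · simp only [if_neg hx]
    push Not at hx
    have hx0 : 0 < x := hτ.trans hx
    split_ifs with hy
    · have key : τ * (x - τ / 2) + (τ / x * y ^ 2 - τ / x * x ^ 2) / 2 - y ^ 2 / 2 =
          (x - τ) * (τ * x - y ^ 2) / (2 * x) := by
        field_simp
        ring
      have hyx : 0 ≤ τ * x - y ^ 2 := by nlinarith
      have : 0 ≤ (x - τ) * (τ * x - y ^ 2) / (2 * x) :=
        div_nonneg (mul_nonneg (by linarith) hyx) (by linarith)
      linarith
    · have key : τ * (x - τ / 2) + (τ / x * y ^ 2 - τ / x * x ^ 2) / 2 - τ * (y - τ / 2) =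
          τ * (x - y) ^ 2 / (2 * x) := by
        field_simp
        ring
      have : 0 ≤ τ * (x - y) ^ 2 / (2 * x) := by positivity
      linarith

theorem huber_nonneg {τ : ℝ} (hτ : 0 < τ) (r : ℝ) : 0 ≤ huber τ r := by
  unfold huber
  split_ifs
  · positivity
  · exact mul_nonneg hτ.le (by linarith)

/-- Convergence of IRLS objective values: if each `θ (t+1)` minimizes the weighted
least-squares surrogate built from the weights at `θ t`, then the sequence of Huber
objective values is nonincreasing, nonnegative, and converges. -/
theorem irls_objective_converges {N p : ℕ} (τ : ℝ) (hτ : 0 < τ)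
    (A : Matrix (Fin N) (Fin p) ℝ) (b : Fin N → ℝ) (θ : ℕ → Fin p → ℝ)
    (hstep : ∀ t, ∀ η : Fin p → ℝ,
      ∑ i, huberWeight τ (b i - A.mulVec (θ t) i) * (b i - A.mulVec (θ (t + 1)) i) ^ 2 ≤
        ∑ i, huberWeight τ (b i - A.mulVec (θ t) i) * (b i - A.mulVec η i) ^ 2) :
    (Antitone fun t => ∑ i, huber τ (b i - A.mulVec (θ t) i)) ∧
      (∀ t, 0 ≤ ∑ i, huber τ (b i - A.mulVec (θ t) i)) ∧
      ∃ L : ℝ, Filter.Tendsto (fun t => ∑ i, huber τ (b i - A.mulVec (θ t) i))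
        Filter.atTop (nhds L) := by
  have hanti : Antitone fun t => ∑ i, huber τ (b i - A.mulVec (θ t) i) := by
    refine antitone_nat_of_succ_le fun t => ?_
    have hmaj := Finset.sum_le_sum fun i (_ : i ∈ Finset.univ) =>
      huber_le_huber_add_huberWeight hτ (b i - A.mulVec (θ t) i) (b i - A.mulVec (θ (t + 1)) i)
    rw [Finset.sum_add_distrib, ← Finset.sum_div, Finset.sum_sub_distrib] at hmaj
    linarith [hstep t (θ t)]
  have hnonneg : ∀ t, 0 ≤ ∑ i, huber τ (b i - A.mulVec (θ t) i) := fun t =>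
    Finset.sum_nonneg fun i _ => huber_nonneg hτ _
  exact ⟨hanti, hnonneg, _, tendsto_atTop_ciInf hanti ⟨0, Set.forall_mem_range.2 hnonneg⟩⟩
end

section
/- (Coercivity of the Huber objective.) Let τ > 0, let A be a real N×p matrix whose associated linear map θ ↦ Aθ is injective, and let b ∈ ℝ^N. Then the Huber objective f(θ) = Σ_{i=1}^N ρ_τ(b_i − (Aθ)_i) is coercive: f(θ) → +∞ as ‖θ‖ → ∞; equivalently, every sublevel set {θ : f(θ) ≤ M} is bounded. -/
theorem mul_abs_sub_le_huber (τ r : ℝ) : τ * (|r| - τ / 2) ≤ huber τ r := by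
  unfold huber
  split_ifs
  · nlinarith [sq_nonneg (|r| - τ), sq_abs r]
  · exact le_rfl

/-- The sum of Huber losses grows at least linearly in the sup norm of the residual. -/
theorem mul_norm_sub_le_sum_huber {ι : Type*} [Fintype ι] {τ : ℝ} (hτ : 0 ≤ τ) (r : ι → ℝ) :
    τ * (‖r‖ - Fintype.card ι * (τ / 2)) ≤ ∑ i, huber τ (r i) := by
  have hnorm : ‖r‖ ≤ ∑ i, |r i| :=
    (pi_norm_le_iff_of_nonneg (Finset.sum_nonneg fun i _ => abs_nonneg (r i))).2 fun i =>
      Finset.single_le_sum (f := fun i => |r i|) (fun j _ => abs_nonneg (r j))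
        (Finset.mem_univ i)
  calc τ * (‖r‖ - Fintype.card ι * (τ / 2))
      ≤ τ * (∑ i, |r i| - Fintype.card ι * (τ / 2)) := by gcongr
    _ = ∑ i, τ * (|r i| - τ / 2) := by
      simp [← Finset.mul_sum, Finset.sum_sub_distrib]
    _ ≤ ∑ i, huber τ (r i) := Finset.sum_le_sum fun i _ => mul_abs_sub_le_huber τ (r i)

/-- Coercivity of the Huber objective: if the linear map `θ ↦ Aθ` is injective, then
the Huber objective tends to `+∞` as `‖θ‖ → ∞`; equivalently, every sublevel set is
bounded. -/
theorem huber_objective_coercive {N p : ℕ} (τ : ℝ) (hτ : 0 < τ)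
    (A : Matrix (Fin N) (Fin p) ℝ) (hA : Function.Injective A.mulVec) (b : Fin N → ℝ) :
    (∀ M : ℝ, ∃ ρ : ℝ, ∀ θ : Fin p → ℝ,
        ρ ≤ ‖θ‖ → M ≤ ∑ i, huber τ (b i - A.mulVec θ i)) ∧
      ∀ M : ℝ, Bornology.IsBounded
        {θ : Fin p → ℝ | ∑ i, huber τ (b i - A.mulVec θ i) ≤ M} := by
  have hgrowth : ∀ M : ℝ, ∃ ρ : ℝ, ∀ θ : Fin p → ℝ,
      ρ ≤ ‖θ‖ → M ≤ ∑ i, huber τ (b i - A.mulVec θ i) := by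
    intro M
    obtain ⟨K, -, hK⟩ := A.mulVecLin.injective_iff_antilipschitz.mp hA
    refine ⟨K * (‖b‖ + (M / τ + N * (τ / 2))) + 1, fun θ hθ => ?_⟩
    by_contra! hM
    have hsum := mul_norm_sub_le_sum_huber hτ.le (b - A.mulVec θ)
    simp only [Pi.sub_apply, Fintype.card_fin] at hsum
    have hres : ‖b - A.mulVec θ‖ - N * (τ / 2) ≤ M / τ := by
      rw [le_div_iff₀' hτ]
      exact hsum.trans hM.le
    have hAθ : ‖A.mulVec θ‖ ≤ ‖b‖ + ‖b - A.mulVec θ‖ := by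
      simpa using norm_sub_le b (b - A.mulVec θ)
    have hθK : ‖θ‖ ≤ K * ‖A.mulVec θ‖ := by
      simpa using hK.le_mul_dist θ 0
    have hle : K * ‖A.mulVec θ‖ ≤ K * (‖b‖ + (M / τ + N * (τ / 2))) := by
      gcongr
      linarith
    linarith
  refine ⟨hgrowth, fun M => ?_⟩
  obtain ⟨ρ, hρ⟩ := hgrowth (M + 1)
  refine isBounded_iff_forall_norm_le.2 ⟨ρ, fun θ hθ => ?_⟩
  by_contra! h
  have hM : _ ≤ M := hθ
  linarith [hρ θ h.le]
end
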